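/- Let r₁, r₂ be positive integers, let U₁ : ℤ → (1×r₁ real matrices), U₂ : ℤ → (r₁×r₂ real matrices), U₃ : ℤ → (r₂×1 real matrices), and define u : ℤ³ → ℝ by u(i,j,k) := the unique entry of U₁(i)·U₂(j)·U₃(k). Fix hy > 0 and define the discrete first derivative along Y by Dy u(i,j,k) := (1/(4hy)) ∑_{m∈{0,1}} ∑_{p∈{0,1}} ( u(i+m, j+1, k+p) − u(i+m, j, k+p) ). Then for all integers i, j, k, Dy u(i,j,k) equals the unique entry of the matrix product ((U₁(i)+U₁(i+1))/2) · ((U₂(j+1)−U₂(j))/hy) · ((U₃(k)+U₃(k+1))/2). -/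

import Mathlib

/-- Discrete first derivative along Y of a grid function `u : ℤ³ → ℝ` with step `hy`. -/
noncomputable def DyGrid (u : ℤ → ℤ → ℤ → ℝ) (hy : ℝ) (i j k : ℤ) : ℝ :=
  (1 / (4 * hy)) * ∑ m ∈ Finset.range 2, ∑ p ∈ Finset.range 2,
    (u (i + (m : ℤ)) (j + 1) (k + (p : ℤ)) - u (i + (m : ℤ)) j (k + (p : ℤ)))

/-- Core-wise form of the discrete first derivative along Y of a rank-separated
(tensor-train) grid function. -/
theorem tt_discrete_first_derivative_Y
    (r₁ r₂ : ℕ) (hr₁ : 0 < r₁) (hr₂ : 0 < r₂)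
    (U₁ : ℤ → Matrix (Fin 1) (Fin r₁) ℝ)
    (U₂ : ℤ → Matrix (Fin r₁) (Fin r₂) ℝ)
    (U₃ : ℤ → Matrix (Fin r₂) (Fin 1) ℝ)
    (u : ℤ → ℤ → ℤ → ℝ)
    (hu : ∀ i j k : ℤ, u i j k = (U₁ i * U₂ j * U₃ k) 0 0)
    (hy : ℝ) (hhy : 0 < hy) :
    ∀ i j k : ℤ,
      DyGrid u hy i j k =
        ((((1 : ℝ) / 2) • (U₁ i + U₁ (i + 1))) *
          ((1 / hy) • (U₂ (j + 1) - U₂ j)) *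
          (((1 : ℝ) / 2) • (U₃ k + U₃ (k + 1)))) 0 0 := by
  intro i j k
  simp only [DyGrid, hu, Finset.sum_range_succ, Finset.sum_range_zero, Nat.cast_zero,
    Nat.cast_one, add_zero, zero_add, Matrix.smul_mul, Matrix.mul_smul, Matrix.add_mul,
    Matrix.mul_add, Matrix.sub_mul, Matrix.mul_sub, Matrix.add_apply, Matrix.sub_apply,
    Matrix.smul_apply, smul_eq_mul]
  field_simp
  ring
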